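/- Assume 𝔭 = 𝔠 and let κ be a regular cardinal with ω ≤ κ ≤ 𝔠. Then there exists a nonprincipal ultrafilter U on ω such that ⟨U, ⊇*⟩ is Tukey equivalent to ⟨[𝔠]^{<κ}, ⊆⟩. -/

import Mathlib

open Cardinal

/-- A subset `S` of a quasiorder `⟨α, r⟩` is bounded if it has an upper bound. -/
def TBounded {α : Type*} (r : α → α → Prop) (S : Set α) : Prop :=
  ∃ b, ∀ x ∈ S, r x b

/-- A subset `C` of `⟨α, r⟩` is cofinal if every element lies below a member of `C`. -/
def TCofinal {α : Type*} (r : α → α → Prop) (C : Set α) : Prop :=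
  ∀ x, ∃ c ∈ C, r x c

/-- A Tukey map: the image of every unbounded set is unbounded. -/
def IsTukeyMap {α β : Type*} (ra : α → α → Prop) (rb : β → β → Prop) (f : α → β) : Prop :=
  ∀ S : Set α, ¬ TBounded ra S → ¬ TBounded rb (f '' S)

/-- Tukey reducibility `P ≤_T Q`: there is a Tukey map from `P` to `Q`. -/
def TukeyLE {α β : Type*} (ra : α → α → Prop) (rb : β → β → Prop) : Prop :=
  ∃ f : α → β, IsTukeyMap ra rb f

/-- Tukey equivalence `P ≡_T Q`. -/
def TukeyEquiv {α β : Type*} (ra : α → α → Prop) (rb : β → β → Prop) : Prop :=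
  TukeyLE ra rb ∧ TukeyLE rb ra

/-- Strict Tukey reducibility `P <_T Q`. -/
def TukeyLT {α β : Type*} (ra : α → α → Prop) (rb : β → β → Prop) : Prop :=
  TukeyLE ra rb ∧ ¬ TukeyLE rb ra

/-- A directed set: a preorder in which every finite subset (in particular `∅` and pairs)
has an upper bound; equivalently, a nonempty directed preorder. -/
structure IsDirectedSet {α : Type*} (r : α → α → Prop) : Prop where
  nonempty : Nonempty α
  refl : ∀ x, r x x
  trans : ∀ {x y z}, r x y → r y z → r x z
  directed : ∀ x y, ∃ z, r x z ∧ r y z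

/-- `U` is a nonprincipal ultrafilter. -/
def Nonprincipal (U : Ultrafilter ℕ) : Prop := ∀ a : ℕ, U ≠ pure a

/-- `⟨U, ⊇⟩`: the members of `U` ordered by reverse inclusion (`A ≤ B` iff `A ⊇ B`). -/
def revIncl (U : Ultrafilter ℕ) : {A : Set ℕ // A ∈ U} → {A : Set ℕ // A ∈ U} → Prop :=
  fun A B => (B : Set ℕ) ⊆ (A : Set ℕ)

/-- `⟨U, ⊇*⟩`: the members of `U` preordered by reverse almost inclusion
(`A ≤ B` iff `A ⊇* B` iff `B \\ A` is finite). -/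
def revAlmostIncl (U : Ultrafilter ℕ) : {A : Set ℕ // A ∈ U} → {A : Set ℕ // A ∈ U} → Prop :=
  fun A B => ((B : Set ℕ) \ (A : Set ℕ)).Finite

/-- A family of subsets of `ω` has the strong finite intersection property if every
finite subfamily has infinite intersection. -/
def HasSFIP (A : Set (Set ℕ)) : Prop :=
  ∀ σ : Finset (Set ℕ), ↑σ ⊆ A → (⋂₀ (↑σ : Set (Set ℕ))).Infinite

/-- `b` is a pseudointersection of the family `A`: an infinite set almost contained
in every member of `A`. -/
def IsPseudoIntersection (b : Set ℕ) (A : Set (Set ℕ)) : Prop :=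
  b.Infinite ∧ ∀ a ∈ A, (b \ a).Finite

/-- The pseudointersection number `𝔭`: the least cardinality of a family of infinite
subsets of `ω` with the SFIP but no pseudointersection. -/
noncomputable def pNum : Cardinal :=
  sInf { c | ∃ A : Set (Set ℕ), #A = c ∧ (∀ a ∈ A, a.Infinite) ∧ HasSFIP A ∧
    ¬ ∃ b, IsPseudoIntersection b A }


/-- Pseudointersections exist for small families on a denumerable type. -/
lemma exists_pseudo (hp : pNum = Cardinal.continuum) {α ι : Type} [Denumerable α]
    (hι : #ι < Cardinal.continuum) (D : ι → Set α)
    (h : ∀ J : Finset ι, (⋂ i ∈ J, D i).Infinite) :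
    ∃ b : Set α, b.Infinite ∧ ∀ i, (b \ D i).Finite := by
  classical
  let e : α ≃ ℕ := Denumerable.eqv α
  let A : Set (Set ℕ) := Set.range fun i => e '' D i
  by_contra hcon
  have hA : #A < Cardinal.continuum := lt_of_le_of_lt Cardinal.mk_range_le hι
  have hmem : #A ∈ { c | ∃ A : Set (Set ℕ), #A = c ∧ (∀ a ∈ A, a.Infinite) ∧ HasSFIP A ∧
    ¬ ∃ b, IsPseudoIntersection b A } := by
    refine ⟨A, rfl, ?_, ?_, ?_⟩
    · rintro _ ⟨i, rfl⟩
      have := h {i}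
      simp only [Finset.mem_singleton, Set.iInter_iInter_eq_left] at this
      exact this.image e.injective.injOn
    · intro σ hσ
      obtain ⟨J, hJ⟩ : ∃ J : Finset ι, J.image (fun i => e '' D i) = σ := by
        have hσ' : (σ : Set (Set ℕ)) ⊆ (fun i => e '' D i) '' Set.univ := by
          simpa [A] using hσ
        obtain ⟨J, -, hJ⟩ := Finset.subset_set_image_iff.1 hσ'
        exact ⟨J, hJ⟩
      refine ((h J).image e.injective.injOn).mono ?_
      rintro _ ⟨x, hx, rfl⟩ s hs
      rw [← hJ] at hs
      simp only [Finset.coe_image, Set.mem_image, Finset.mem_coe] at hs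
      obtain ⟨i, hi, rfl⟩ := hs
      simp only [Set.mem_iInter] at hx
      exact ⟨x, hx i hi, rfl⟩
    · rintro ⟨b, hb, hb'⟩
      refine hcon ⟨e ⁻¹' b, hb.preimage (by simp), fun i => ?_⟩
      have h1 := hb' _ ⟨i, rfl⟩
      refine (h1.preimage e.injective.injOn).subset ?_
      rintro x ⟨hx, hx'⟩
      exact ⟨hx, by simpa using hx'⟩
  have := csInf_le' hmem
  change pNum ≤ _ at this
  rw [hp] at this
  exact absurd this (not_le.2 hA)

/-- The basic lemma: a sequence of finite sets. -/
lemma exists_seq (hp : pNum = Cardinal.continuum) {ι ι' : Type}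
    (hι : #ι < Cardinal.continuum) (hι' : #ι' < Cardinal.continuum)
    (Y : ι → Set ℕ) (X : ι' → Set ℕ)
    (h : ∀ i, ∀ J : Finset ι', (Y i ∩ ⋂ j ∈ J, X j).Infinite) :
    ∃ s : ℕ → Finset ℕ, (∀ i j, i < j → ∀ m ∈ s i, ∀ n ∈ s j, m < n) ∧
      (∀ k, ∀ m ∈ s k, k ≤ m) ∧
      (∀ i, ∃ K, ∀ k ≥ K, ∃ m ∈ s k, m ∈ Y i) ∧
      (∀ j, ∃ K, ∀ k ≥ K, ∀ m ∈ s k, m ∈ X j) := by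
  classical
  rcases isEmpty_or_nonempty ι with hemp | ⟨⟨i0⟩⟩
  · exact ⟨fun _ => ∅, by simp, by simp, fun i => hemp.elim i, by simp⟩
  let D : ι ⊕ (ι' ⊕ ℕ) → Set (Finset ℕ) := fun q => match q with
    | .inl i => {s | ∃ m ∈ s, m ∈ Y i}
    | .inr (.inl j) => {s | ∀ m ∈ s, m ∈ X j}
    | .inr (.inr n) => {s | ∀ m ∈ s, n ≤ m}
  have hcard : #(ι ⊕ (ι' ⊕ ℕ)) < Cardinal.continuum := by
    have hc := Cardinal.aleph0_le_continuum
    simp only [Cardinal.mk_sum, Cardinal.lift_id]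
    refine Cardinal.add_lt_of_lt hc hι (Cardinal.add_lt_of_lt hc hι' ?_)
    simpa using Cardinal.aleph0_lt_continuum
  obtain ⟨b, hb, hbD⟩ := exists_pseudo hp hcard D (by
    intro J hfin
    -- an upper bound for all elements of members of the intersection
    let N : ℕ := (hfin.toFinset.sup id).sup id + 1
    let M : ℕ := J.toRight.toRight.sup id
    have hch : ∀ i, ∃ m, m ∈ Y i ∧ (∀ j ∈ J.toRight.toLeft, m ∈ X j) ∧ max N M ≤ m := by
      intro i
      obtain ⟨m, hm, hm'⟩ := (h i J.toRight.toLeft).exists_gt (max N M)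
      exact ⟨m, hm.1, by simpa using hm.2, hm'.le⟩
    choose f hf1 hf2 hf3 using hch
    let s : Finset ℕ := (insert i0 J.toLeft).image f
    have hs : s ∈ ⋂ i ∈ J, D i := by
      simp only [Set.mem_iInter]
      rintro (i | j | n) hq
      · exact ⟨f i, Finset.mem_image_of_mem _ (by simp [hq]), hf1 i⟩
      · intro m hm
        obtain ⟨i, -, rfl⟩ := Finset.mem_image.1 hm
        exact hf2 i j (by simpa using hq)
      · intro m hm
        obtain ⟨i, -, rfl⟩ := Finset.mem_image.1 hm
        have h1 : n ≤ M := Finset.le_sup (f := id) (by simpa using hq)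
        exact h1.trans ((le_max_right _ _).trans (hf3 i))
    have h1 : f i0 ∈ s := Finset.mem_image_of_mem _ (by simp)
    have h2 : s ⊆ hfin.toFinset.sup id := Finset.le_sup (f := id) (hfin.mem_toFinset.2 hs)
    have h3 : f i0 ≤ (hfin.toFinset.sup id).sup id := Finset.le_sup (f := id) (h2 h1)
    have h4 := (le_max_left _ _).trans (hf3 i0)
    omega)
  -- extract a sequence
  have hgt : ∀ n (F : Finset (Finset ℕ)), ∃ s ∈ b, s ∉ F ∧ ∀ m ∈ s, n ≤ m := by
    intro n F
    have h1 : (b \ ((b \ D (.inr (.inr n))) ∪ F)).Infinite :=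
      hb.sdiff ((hbD (.inr (.inr n))).union F.finite_toSet)
    obtain ⟨s, hs, hs'⟩ := h1.nonempty
    simp only [Set.mem_union, not_or, Set.mem_sdiff, not_and, not_not] at hs'
    exact ⟨s, hs, by simpa using hs'.2, hs'.1 hs⟩
  choose g hgb hgF hgn using hgt
  -- state: finite set of used finsets
  let st : ℕ → Finset (Finset ℕ) := fun k => Nat.rec ∅
    (fun k F => insert (g (max k ((F.sup id).sup id + 1)) F) F) k
  let s : ℕ → Finset ℕ := fun k => g (max k (((st k).sup id).sup id + 1)) (st k)
  have hst : ∀ k, st (k+1) = insert (s k) (st k) := fun k => rfl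
  have hmono : Monotone st := monotone_nat_of_le_succ fun k => by
    rw [hst]; exact Finset.subset_insert _ _
  have hmem : ∀ i j, i < j → s i ∈ st j := fun i j hij =>
    hmono (Nat.succ_le_of_lt hij) (by rw [hst]; exact Finset.mem_insert_self _ _)
  have hinj : Function.Injective s := by
    have key : ∀ i j, i < j → s i ≠ s j := fun i j hij he =>
      hgF (max j (((st j).sup id).sup id + 1)) (st j) (show s j ∈ st j from he ▸ hmem i j hij)
    intro i j he
    rcases lt_trichotomy i j with hij | hij | hij
    · exact absurd he (key _ _ hij)
    · exact hij
    · exact absurd he.symm (key _ _ hij)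
  have hev : ∀ q, ∃ K, ∀ k ≥ K, s k ∈ D q := by
    intro q
    have hf : {k | s k ∉ D q}.Finite := by
      refine ((hbD q).preimage hinj.injOn).subset ?_
      intro k hk
      exact ⟨hgb _ _, hk⟩
    obtain ⟨K, hK⟩ := hf.bddAbove
    refine ⟨K + 1, fun k hk => ?_⟩
    by_contra hcon
    have : k ≤ K := hK hcon
    omega
  refine ⟨s, ?_, ?_, fun i => hev (.inl i), fun j => hev (.inr (.inl j))⟩
  · intro i j hij m hm n hn
    have h1 := hgn _ _ n hn
    have h2 : s i ⊆ (st j).sup id := Finset.le_sup (f := id) (hmem i j hij)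
    have h3 : m ≤ ((st j).sup id).sup id := Finset.le_sup (f := id) (h2 hm)
    have h4 := (le_max_right _ _).trans h1
    omega
  · intro k m hm
    exact (le_max_left _ _).trans (hgn _ _ m hm)

/-- A set almost contained in each `X j` and meeting each `Y i` in an infinite set. -/
lemma exists_key (hp : pNum = Cardinal.continuum) {ι ι' : Type}
    (hι : #ι < Cardinal.continuum) (hι' : #ι' < Cardinal.continuum)
    (Y : ι → Set ℕ) (X : ι' → Set ℕ)
    (h : ∀ i, ∀ J : Finset ι', (Y i ∩ ⋂ j ∈ J, X j).Infinite) :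
    ∃ p : Set ℕ, (∀ i, (p ∩ Y i).Infinite) ∧ ∀ j, (p \ X j).Finite := by
  obtain ⟨s, -, hs2, hs3, hs4⟩ := exists_seq hp hι hι' Y X h
  refine ⟨{m | ∃ k, m ∈ s k}, fun i => ?_, fun j => ?_⟩
  · obtain ⟨K, hK⟩ := hs3 i
    refine Set.infinite_of_not_bddAbove ?_
    rintro ⟨B, hB⟩
    obtain ⟨m, hm, hm'⟩ := hK (max K (B+1)) (le_max_left _ _)
    have h1 : m ≤ B := hB ⟨⟨_, hm⟩, hm'⟩
    have h2 := (le_max_right _ _).trans (hs2 _ m hm)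
    omega
  · obtain ⟨K, hK⟩ := hs4 j
    refine (Set.Finite.biUnion (Set.finite_lt_nat K) fun k _ => (s k).finite_toSet).subset ?_
    rintro m ⟨⟨k, hk⟩, hm⟩
    simp only [Set.mem_iUnion]
    refine ⟨k, ?_, hk⟩
    by_contra hc
    exact hm (hK k (by simpa using hc) m hk)

/-- A set splitting each `Y i`. -/
lemma exists_split (hp : pNum = Cardinal.continuum) {ι : Type}
    (hι : #ι < Cardinal.continuum)
    (Y : ι → Set ℕ) (h : ∀ i, (Y i).Infinite) :
    ∃ p : Set ℕ, ∀ i, (Y i ∩ p).Infinite ∧ (Y i \ p).Infinite := by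
  obtain ⟨s, hs1, hs2, hs3, -⟩ := exists_seq hp hι (ι' := Empty)
    (by simpa using Cardinal.continuum_pos) Y (fun j => j.elim) (by
      intro i J
      simpa [Finset.eq_empty_of_isEmpty J] using h i)
  refine ⟨{m | ∃ k, m ∈ s (2 * k)}, fun i => ⟨?_, ?_⟩⟩
  · obtain ⟨K, hK⟩ := hs3 i
    refine Set.infinite_of_not_bddAbove ?_
    rintro ⟨B, hB⟩
    obtain ⟨m, hm, hm'⟩ := hK (2 * max K (B+1)) (by have := le_max_left K (B+1); omega)
    have h1 : m ≤ B := hB ⟨hm', ⟨_, hm⟩⟩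
    have h2 := hs2 _ m hm
    have := le_max_right K (B+1)
    omega
  · obtain ⟨K, hK⟩ := hs3 i
    refine Set.infinite_of_not_bddAbove ?_
    rintro ⟨B, hB⟩
    obtain ⟨m, hm, hm'⟩ := hK (2 * max K (B+1) + 1) (by have := le_max_left K (B+1); omega)
    have h1 : m ≤ B := hB ⟨hm', by
      rintro ⟨k, hk⟩
      rcases lt_trichotomy (2 * k) (2 * max K (B+1) + 1) with hlt | heq | hgt
      · exact absurd (hs1 _ _ hlt m hk m hm) (lt_irrefl _)
      · omega
      · exact absurd (hs1 _ _ hgt m hm m hk) (lt_irrefl _)⟩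
    have h2 := hs2 _ m hm
    have := le_max_right K (B+1)
    omega

/-- Branches. -/
noncomputable def branchSet (x : Set ℕ) : Set ℕ := by
  classical
  exact Set.range fun n : ℕ => Encodable.encode (((Finset.range n).filter (· ∈ x), n) : Finset ℕ × ℕ)

lemma branchSet_infinite (x : Set ℕ) : (branchSet x).Infinite := by
  classical
  refine Set.infinite_range_of_injective ?_
  intro m n h
  have := Encodable.encode_injective h
  exact (Prod.ext_iff.1 this).2

lemma branchSet_inter {x y : Set ℕ} (h : x ≠ y) : (branchSet x ∩ branchSet y).Finite := by
  classical
  obtain ⟨k, hk⟩ : ∃ k, ¬ (k ∈ x ↔ k ∈ y) := by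
    by_contra hc
    push Not at hc
    exact h (Set.ext hc)
  refine ((Set.finite_le_nat k).image fun n : ℕ =>
    Encodable.encode (((Finset.range n).filter (· ∈ x), n) : Finset ℕ × ℕ)).subset ?_
  rintro _ ⟨⟨n, rfl⟩, ⟨m, hm⟩⟩
  refine ⟨n, ?_, rfl⟩
  have h1 := Encodable.encode_injective hm
  obtain ⟨h2, h3⟩ := Prod.ext_iff.1 h1
  simp only at h2 h3
  subst h3
  by_contra hc
  simp only [Set.mem_ofPred_eq, not_le] at hc
  have := Finset.ext_iff.1 h2 k
  simp only [Finset.mem_filter, Finset.mem_range, hc, true_and] at this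
  exact hk this.symm

lemma two_power_le (hp : pNum = Cardinal.continuum) (c : Cardinal.{0})
    (hc : c < Cardinal.continuum) : (2 : Cardinal) ^ c ≤ Cardinal.continuum := by
  classical
  induction c using Cardinal.inductionOn with | _ L
  have h1 : #L ≤ #(Set ℕ) := by simpa using hc.le
  obtain ⟨e⟩ := h1
  have hZ : ∀ Z : Set L, ∃ r : Set ℕ, ∀ l, l ∈ Z ↔ (r ∩ branchSet (e l)).Infinite := by
    intro Z
    obtain ⟨p, hp1, hp2⟩ := exists_key hp (ι := Z) (ι' := (Zᶜ : Set L))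
      ((Cardinal.mk_set_le _).trans_lt hc) ((Cardinal.mk_set_le _).trans_lt hc)
      (fun l => branchSet (e l)) (fun l => (branchSet (e l))ᶜ) (by
        intro l J
        have : (branchSet (e l) \ ⋃ j ∈ J, (branchSet (e l) ∩ branchSet (e j))).Infinite := by
          refine (branchSet_infinite _).sdiff ?_
          refine J.finite_toSet.biUnion fun j _ => branchSet_inter fun he => ?_
          have := e.injective he
          exact j.2 (this ▸ l.2)
        refine this.mono ?_
        rintro m ⟨hm, hm'⟩
        refine ⟨hm, ?_⟩
        simp only [Set.mem_iUnion, not_exists] at hm'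
        simp only [Set.mem_iInter]
        intro j hj hmj
        exact hm' j hj ⟨hm, hmj⟩)
    refine ⟨p, fun l => ⟨fun hl => hp1 ⟨l, hl⟩, fun hl => ?_⟩⟩
    by_contra hlZ
    refine hl ((hp2 ⟨l, hlZ⟩).subset ?_)
    rintro m ⟨hm, hm'⟩
    exact ⟨hm, fun h => h hm'⟩
  choose r hr using hZ
  have hinj : Function.Injective r := by
    intro Z Z' hZ
    ext l
    rw [hr, hr, hZ]
  have := Cardinal.mk_le_of_injective hinj
  simpa using this

lemma mk_small_le (hp : pNum = Cardinal.continuum) (κ : Cardinal.{0})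
    (hκc : κ ≤ Cardinal.continuum) :
    #{S : Set (Set ℕ) // #S < κ} ≤ Cardinal.continuum := by
  classical
  let I := Cardinal.continuum.{0}.ord.ToType
  have hI : #I = Cardinal.continuum := Cardinal.mk_ord_toType _
  have hsub : {S : Set (Set ℕ) | #S < κ} ⊆ ⋃ i : I, {S : Set (Set ℕ) | #S ≤ #(Set.Iio i)} := by
    intro S hS
    have hlt : (#S).ord < Cardinal.continuum.{0}.ord :=
      Cardinal.ord_lt_ord.2 (lt_of_lt_of_le hS hκc)
    simp only [Set.mem_iUnion, Set.mem_ofPred_eq]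
    refine ⟨Ordinal.ToType.mk ⟨_, hlt⟩, ?_⟩
    have h1 : (Ordinal.ToType.mk.symm (Ordinal.ToType.mk (⟨_, hlt⟩ : Set.Iio _)) : Ordinal) = (#S).ord := by
      simp
    have h2 := congrArg Ordinal.card h1
    rw [Cardinal.card_ord] at h2
    exact h2.ge
  refine (Cardinal.mk_le_mk_of_subset hsub).trans ?_
  refine (Cardinal.mk_iUnion_le _).trans ?_
  rw [hI]
  refine (mul_le_mul_right (ciSup_le' fun i => ?_) _).trans Cardinal.continuum_mul_self.le
  have hlt : #(Set.Iio i) < Cardinal.continuum := by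
    simpa [I] using Cardinal.mk_Iio_lt i (by simp [I])
  refine (Cardinal.mk_bounded_set_le (Set ℕ) (#(Set.Iio i))).trans ?_
  have : max #(Set ℕ) ℵ₀ = 2 ^ ℵ₀ := by
    simp [Cardinal.aleph0_le_continuum]
  rw [this, ← Cardinal.power_mul]
  exact two_power_le hp _ (Cardinal.mul_lt_of_lt Cardinal.aleph0_le_continuum
    Cardinal.aleph0_lt_continuum hlt)

/-- Intersection of finitely many members of the sequence. -/
def seqInter {I : Type} (e : I → Set ℕ) (t : Finset I) : Set ℕ := {m | ∀ δ ∈ t, m ∈ e δ}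

/-- Union of finitely many members of the sequence. -/
def seqUnion {I : Type} (e : I → Set ℕ) (t : Finset I) : Set ℕ := {m | ∃ δ ∈ t, m ∈ e δ}

/-- The requirement on the set `a` chosen at stage `β`. -/
structure StepOK {I : Type} [LinearOrder I] (κ : Cardinal.{0}) (S : I → Set (Set ℕ)) (β : I)
    (e : I → Set ℕ) (a : Set ℕ) : Prop where
  split : ∀ t σ : Finset I, (∀ δ ∈ t, δ < β) → (∀ δ ∈ σ, δ < β) →
    (seqInter e t \ seqUnion e σ).Infinite → ((seqInter e t \ seqUnion e σ) \ a).Infinite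
  good : ∀ t : Finset I, (∀ δ ∈ t, δ < β) → ∃ T : Set I, #T < κ ∧
    ∀ σ : Finset I, (∀ δ ∈ σ, δ < β) → (∀ δ ∈ σ, δ ∉ T) →
      ((seqInter e t ∩ a) \ seqUnion e σ).Infinite
  decide : (∀ x ∈ S β, (a \ x).Finite) ∨ ∃ x ∈ S β, (a ∩ x).Finite

lemma seqInter_congr {I : Type} {e e' : I → Set ℕ} {t : Finset I} (h : ∀ δ ∈ t, e δ = e' δ) :
    seqInter e t = seqInter e' t := by
  ext m
  exact forall₂_congr fun δ hδ => by rw [h δ hδ]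

lemma seqUnion_congr {I : Type} {e e' : I → Set ℕ} {t : Finset I} (h : ∀ δ ∈ t, e δ = e' δ) :
    seqUnion e t = seqUnion e' t := by
  ext m
  constructor
  · rintro ⟨δ, hδ, hm⟩
    exact ⟨δ, hδ, h δ hδ ▸ hm⟩
  · rintro ⟨δ, hδ, hm⟩
    exact ⟨δ, hδ, (h δ hδ).symm ▸ hm⟩

lemma StepOK.congr {I : Type} [LinearOrder I] {κ : Cardinal.{0}} {S : I → Set (Set ℕ)} {β : I}
    {e e' : I → Set ℕ} {a : Set ℕ} (h : StepOK κ S β e a) (he : ∀ δ < β, e δ = e' δ) :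
    StepOK κ S β e' a where
  split t σ ht hσ := by
    rw [← seqInter_congr fun δ hδ => he δ (ht δ hδ), ← seqUnion_congr fun δ hδ => he δ (hσ δ hδ)]
    exact h.split t σ ht hσ
  good t ht := by
    obtain ⟨T, hT, hT'⟩ := h.good t ht
    refine ⟨T, hT, fun σ hσ hσ' => ?_⟩
    rw [← seqInter_congr fun δ hδ => he δ (ht δ hδ), ← seqUnion_congr fun δ hδ => he δ (hσ δ hδ)]
    exact hT' σ hσ hσ'
  decide := h.decide

lemma seqInter_insert {I : Type} [DecidableEq I] (e : I → Set ℕ) (β : I) (t : Finset I) :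
    seqInter e (insert β t) = seqInter e t ∩ e β := by
  ext m
  simp [seqInter, and_comm]

lemma seqUnion_insert {I : Type} [DecidableEq I] (e : I → Set ℕ) (β : I) (t : Finset I) :
    seqUnion e (insert β t) = seqUnion e t ∪ e β := by
  ext m
  simp [seqUnion, or_comm]

/-- Generic recursion. -/
lemma exists_rec {I : Type} [LinearOrder I] [WellFoundedLT I]
    (R : I → (I → Set ℕ) → Set ℕ → Prop)
    (hR : ∀ β e e' a, (∀ δ < β, e δ = e' δ) → R β e a → R β e' a)
    (hex : ∀ β e, (∀ δ < β, R δ e (e δ)) → ∃ a, R β e a) :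
    ∃ e : I → Set ℕ, ∀ β, R β e (e β) := by
  classical
  let ext : (β : I) → ((δ : I) → δ < β → Set ℕ) → I → Set ℕ :=
    fun β f δ => if h : δ < β then f δ h else Set.univ
  let F : (β : I) → ((δ : I) → δ < β → Set ℕ) → Set ℕ :=
    fun β f => if h : ∃ a, R β (ext β f) a then h.choose else Set.univ
  let e : I → Set ℕ := (wellFounded_lt (α := I)).fix F
  have hfix : ∀ β, e β = F β (fun δ _ => e δ) := fun β => WellFounded.fix_eq _ _ _
  have hext : ∀ β, ∀ δ < β, ext β (fun δ _ => e δ) δ = e δ := fun β δ h => by simp [ext, h]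
  refine ⟨e, fun β => ?_⟩
  induction β using WellFoundedLT.induction with | _ β ih
  obtain ⟨a, ha⟩ := hex β e ih
  have h : ∃ a, R β (ext β fun δ _ => e δ) a :=
    ⟨a, hR β e _ a (fun δ hδ => (hext β δ hδ).symm) ha⟩
  have h2 : e β = h.choose := by
    rw [hfix]
    simp only [F]
    rw [dif_pos h]
  rw [h2]
  exact hR β _ e _ (hext β) h.choose_spec

/-- Goodness propagates. -/
lemma good_of_step {I : Type} [LinearOrder I] {κ : Cardinal.{0}} (hκ : ℵ₀ ≤ κ)
    {S : I → Set (Set ℕ)} {e : I → Set ℕ} (D : Set I) (hD : ∀ δ ∈ D, StepOK κ S δ e (e δ))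
    (t : Finset I) (ht : ∀ δ ∈ t, δ ∈ D) :
    ∃ T : Set I, #T < κ ∧ ∀ σ : Finset I, (∀ δ ∈ σ, δ ∈ D) → (∀ δ ∈ σ, δ ∉ T) →
      (seqInter e t \ seqUnion e σ).Infinite := by
  classical
  induction t using Finset.induction_on_max with
  | empty =>
    refine ⟨∅, by simpa using (Cardinal.aleph0_pos.trans_le hκ), fun σ => ?_⟩
    induction σ using Finset.induction_on_max with
    | empty =>
      intro _ _
      have : seqInter e (∅ : Finset I) \ seqUnion e ∅ = Set.univ := by
        ext; simp [seqInter, seqUnion]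
      rw [this]
      exact Set.infinite_univ
    | insert m σ hm ih =>
      intro hσ _
      have h1 := ih (fun δ hδ => hσ δ (Finset.mem_insert_of_mem hδ)) (by simp)
      have h2 := (hD m (hσ m (Finset.mem_insert_self _ _))).split ∅ σ (by simp) hm h1
      rw [seqUnion_insert]
      rwa [Set.sdiff_sdiff] at h2
  | insert β t hβ _ =>
    obtain ⟨T, hT, hT'⟩ := (hD β (ht β (Finset.mem_insert_self _ _))).good t hβ
    refine ⟨insert β T, ?_, fun σ => ?_⟩
    · refine (Cardinal.mk_insert_le).trans_lt ?_
      exact Cardinal.add_lt_of_lt hκ hT (Cardinal.one_lt_aleph0.trans_le hκ)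
    rw [seqInter_insert]
    induction σ using Finset.induction_on_max with
    | empty =>
      intro _ _
      exact hT' ∅ (by simp) (by simp)
    | insert m σ hm ih =>
      intro hσ hσT
      rcases lt_trichotomy m β with hlt | heq | hgt
      · refine hT' _ ?_ fun δ hδ h => hσT δ hδ (Set.mem_insert_of_mem _ h)
        intro δ hδ
        rcases Finset.mem_insert.1 hδ with rfl | h
        · exact hlt
        · exact (hm δ h).trans hlt
      · exact absurd (Set.mem_insert_iff.2 (Or.inl heq)) (hσT m (Finset.mem_insert_self _ _))
      · have h1 := ih (fun δ hδ => hσ δ (Finset.mem_insert_of_mem hδ))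
          (fun δ hδ => hσT δ (Finset.mem_insert_of_mem hδ))
        rw [← seqInter_insert] at h1 ⊢
        have h2 := (hD m (hσ m (Finset.mem_insert_self _ _))).split (insert β t) σ (by
          intro δ hδ
          rcases Finset.mem_insert.1 hδ with rfl | h
          · exact hgt
          · exact (hβ δ h).trans hgt) hm h1
        rw [seqUnion_insert]
        rwa [Set.sdiff_sdiff] at h2

lemma mk_finset_lt {α : Type} {κ : Cardinal.{0}} (hκ : ℵ₀ ≤ κ) (h : #α < κ) :
    #(Finset α) < κ := by
  rcases finite_or_infinite α with hf | hf
  · exact (Cardinal.lt_aleph0_of_finite _).trans_le hκ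
  · rwa [Cardinal.mk_finset_of_infinite]

/-- The successor step can be carried out. -/
lemma exists_step (hp : pNum = Cardinal.continuum) {I : Type} [LinearOrder I]
    (hI : ∀ β : I, #(Set.Iio β) < Cardinal.continuum)
    {κ : Cardinal.{0}} (hreg : κ.IsRegular) (hκc : κ ≤ Cardinal.continuum)
    (S : I → Set (Set ℕ)) (hS : ∀ β, #(S β) < κ) (β : I) (e : I → Set ℕ)
    (hprev : ∀ δ < β, StepOK κ S δ e (e δ)) : ∃ a, StepOK κ S β e a := by
  classical
  have hκ := hreg.aleph0_le
  have hc := Cardinal.aleph0_le_continuum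
  have hgood := good_of_step hκ (Set.Iio β) hprev
  let G := Finset (Set.Iio β)
  have hG : #G < Cardinal.continuum := mk_finset_lt hc (hI β)
  let up : G → Finset I := fun t => t.map (Function.Embedding.subtype _)
  have hup : ∀ t : G, ∀ δ ∈ up t, δ < β := by
    intro t δ hδ
    obtain ⟨x, -, rfl⟩ := Finset.mem_map.1 hδ
    exact x.2
  have hsurj : ∀ t : Finset I, (∀ δ ∈ t, δ < β) → ∃ t' : G, up t' = t := by
    intro t ht
    refine ⟨t.subtype (· ∈ Set.Iio β), ?_⟩
    exact Finset.subtype_map_of_mem ht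
  have hGG : #(G × G) < Cardinal.continuum := by
    simpa using Cardinal.mul_lt_of_lt hc hG hG
  -- the splitting set
  obtain ⟨a0, ha0⟩ := exists_split hp
    (ι := {q : G × G // (seqInter e (up q.1) \ seqUnion e (up q.2)).Infinite})
    ((Cardinal.mk_subtype_le _).trans_lt hGG)
    (fun q => seqInter e (up q.1.1) \ seqUnion e (up q.1.2)) (fun q => q.2)
  have hsplit : ∀ t σ : Finset I, (∀ δ ∈ t, δ < β) → (∀ δ ∈ σ, δ < β) →
      (seqInter e t \ seqUnion e σ).Infinite →
      ((seqInter e t \ seqUnion e σ) ∩ a0).Infinite ∧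
      ((seqInter e t \ seqUnion e σ) \ a0).Infinite := by
    intro t σ ht hσ h
    obtain ⟨t, rfl⟩ := hsurj t ht
    obtain ⟨σ, rfl⟩ := hsurj σ hσ
    exact ha0 ⟨(t, σ), h⟩
  let Good : Set ℕ → Prop := fun x => ∃ T : Set I, #T < κ ∧
    ∀ σ : Finset I, (∀ δ ∈ σ, δ < β) → (∀ δ ∈ σ, δ ∉ T) → (x \ seqUnion e σ).Infinite
  have hmono : ∀ x y, x ⊆ y → Good x → Good y := by
    rintro x y hxy ⟨T, hT, h⟩
    exact ⟨T, hT, fun σ h1 h2 => (h σ h1 h2).mono (Set.sdiff_subset_sdiff_left hxy)⟩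
  have hgrill : ∀ x y, Good x → Good (x ∩ y) ∨ Good (x \ y) := by
    rintro x y ⟨T, hT, h⟩
    by_contra hcon
    simp only [not_or, Good, not_exists, not_and, not_forall] at hcon
    obtain ⟨σ, h1, h2, h3⟩ := hcon.1 T hT
    obtain ⟨σ', h1', h2', h3'⟩ := hcon.2 T hT
    refine h (σ ∪ σ') ?_ ?_ (((Set.not_infinite.1 h3).union (Set.not_infinite.1 h3')).subset ?_)
    · intro δ hδ
      rcases Finset.mem_union.1 hδ with h | h
      · exact h1 δ h
      · exact h1' δ h
    · intro δ hδ
      rcases Finset.mem_union.1 hδ with h | h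
      · exact h2 δ h
      · exact h2' δ h
    · rintro m ⟨hm, hm'⟩
      by_cases hy : m ∈ y
      · exact Or.inl ⟨⟨hm, hy⟩, fun ⟨δ, hδ, h⟩ => hm' ⟨δ, Finset.mem_union_left _ hδ, h⟩⟩
      · exact Or.inr ⟨⟨hm, hy⟩, fun ⟨δ, hδ, h⟩ => hm' ⟨δ, Finset.mem_union_right _ hδ, h⟩⟩
  have hN : ∀ t : Finset I, (∀ δ ∈ t, δ < β) → Good (seqInter e t ∩ a0) := by
    intro t ht
    obtain ⟨T, hT, h⟩ := hgood t ht
    refine ⟨T, hT, fun σ h1 h2 => ?_⟩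
    refine (hsplit t σ ht h1 (h σ h1 h2)).1.mono ?_
    rintro m ⟨⟨h1, h2⟩, h3⟩
    exact ⟨⟨h1, h3⟩, h2⟩
  have hsub : ∀ a ⊆ a0, ∀ t σ : Finset I, (∀ δ ∈ t, δ < β) → (∀ δ ∈ σ, δ < β) →
      (seqInter e t \ seqUnion e σ).Infinite →
      ((seqInter e t \ seqUnion e σ) \ a).Infinite := by
    intro a ha t σ ht hσ h
    exact (hsplit t σ ht hσ h).2.mono (Set.sdiff_subset_sdiff_right ha)
  by_cases hcase : ∃ x ∈ S β, ∀ t : Finset I, (∀ δ ∈ t, δ < β) → Good ((seqInter e t ∩ a0) \ x)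
  · obtain ⟨x, hx, hgx⟩ := hcase
    refine ⟨a0 \ x, hsub _ Set.sdiff_subset, ?_, Or.inr ⟨x, hx, ?_⟩⟩
    · intro t ht
      have := hgx t ht
      rw [← Set.inter_sdiff_assoc]
      exact this
    · simp
  · push Not at hcase
    choose! tx htx hbad using hcase
    have hJ : ∀ J : Finset (S β), ∀ t : Finset I, (∀ δ ∈ t, δ < β) →
        Good ((seqInter e t ∩ a0) ∩ ⋂ j ∈ J, (j : Set ℕ)) := by
      intro J
      induction J using Finset.induction_on with
      | empty =>
        intro t ht
        simpa using hN t ht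
      | insert x J _ ih =>
        intro t ht
        have h1 := ih (t ∪ tx x) (by
          intro δ hδ
          rcases Finset.mem_union.1 hδ with h | h
          · exact ht δ h
          · exact htx x x.2 δ h)
        rcases hgrill _ x h1 with h2 | h2
        · refine hmono _ _ ?_ h2
          rintro m ⟨⟨⟨hm1, hm2⟩, hm3⟩, hm4⟩
          refine ⟨⟨fun δ hδ => hm1 δ (Finset.mem_union_left _ hδ), hm2⟩, ?_⟩
          simp only [Set.mem_iInter, Finset.mem_insert] at hm3 ⊢
          rintro j (rfl | hj)
          · exact hm4
          · exact hm3 j hj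
        · refine absurd (hmono _ _ ?_ h2) (hbad x x.2)
          rintro m ⟨⟨⟨hm1, hm2⟩, hm3⟩, hm4⟩
          exact ⟨⟨fun δ hδ => hm1 δ (Finset.mem_union_right _ hδ), hm2⟩, hm4⟩
    have hJ' : ∀ (t : G) (J : Finset (S β)), Good ((seqInter e (up t) ∩ a0) ∩ ⋂ j ∈ J, (j : Set ℕ)) :=
      fun t J => hJ J (up t) (hup t)
    choose T hT hTinf using hJ'
    let TT : G → Set I := fun t => ⋃ J, T t J
    have hTT : ∀ t, #(TT t) < κ := fun t =>
      (Cardinal.card_iUnion_lt_iff_forall_of_isRegular hreg (mk_finset_lt hκ (hS β))).2 (hT t)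
    obtain ⟨p, hp1, hp2⟩ := exists_key hp
      (ι := {q : G × G // ∀ δ ∈ up q.2, δ ∉ TT q.1}) (ι' := S β)
      ((Cardinal.mk_subtype_le _).trans_lt hGG) ((hS β).trans_le hκc)
      (fun q => (seqInter e (up q.1.1) ∩ a0) \ seqUnion e (up q.1.2)) (fun x => x) (by
        rintro ⟨⟨t, σ⟩, hq⟩ J
        refine (hTinf t J (up σ) (hup σ) fun δ hδ h => hq δ hδ (Set.mem_iUnion.2 ⟨J, h⟩)).mono ?_
        rintro m ⟨⟨h1, h2⟩, h3⟩
        exact ⟨⟨h1, h3⟩, h2⟩)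
    refine ⟨a0 ∩ p, hsub _ Set.inter_subset_left, ?_, Or.inl fun x hx => ?_⟩
    · intro t ht
      obtain ⟨t, rfl⟩ := hsurj t ht
      refine ⟨TT t, hTT t, fun σ hσ hσ' => ?_⟩
      obtain ⟨σ, rfl⟩ := hsurj σ hσ
      refine (hp1 ⟨(t, σ), hσ'⟩).mono ?_
      rintro m ⟨h1, ⟨⟨h2, h3⟩, h4⟩⟩
      exact ⟨⟨h2, h3, h1⟩, h4⟩
    · exact (hp2 ⟨x, hx⟩).subset (Set.sdiff_subset_sdiff_left Set.inter_subset_right)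

/-- Assuming `𝔭 = 𝔠`, for every regular cardinal `κ` with `ω ≤ κ ≤ 𝔠` there is a
nonprincipal ultrafilter `U` on `ω` with `⟨U, ⊇*⟩ ≡_T ⟨[𝔠]^{<κ}, ⊆⟩`. -/
theorem stmt19 (hp : pNum = Cardinal.continuum)
    (κ : Cardinal) (hκreg : κ.ord.cof = κ) (hκ0 : Cardinal.aleph0 ≤ κ)
    (hκc : κ ≤ Cardinal.continuum) :
    ∃ U : Ultrafilter ℕ, Nonprincipal U ∧
      ∀ C : Type, #C = Cardinal.continuum →
        TukeyEquiv (revAlmostIncl U)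
          (fun s t : {s : Set C // #s < κ} => (s : Set C) ⊆ (t : Set C)) := by
  classical
  have hreg : κ.IsRegular := ⟨hκ0, hκreg.ge⟩
  let I := Cardinal.continuum.{0}.ord.ToType
  have hIc : #I = Cardinal.continuum := Cardinal.mk_ord_toType _
  have hI : ∀ β : I, #(Set.Iio β) < Cardinal.continuum := fun β => by
    simpa [I] using Cardinal.mk_Iio_lt β (by simp [I])
  -- enumeration of the small families
  obtain ⟨S', hS'⟩ : ∃ f : I → {S : Set (Set ℕ) // #S < κ}, Function.Surjective f := by
    have hle : #{S : Set (Set ℕ) // #S < κ} ≤ #I := (mk_small_le hp κ hκc).trans hIc.ge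
    obtain ⟨g⟩ := hle
    haveI : Nonempty {S : Set (Set ℕ) // #S < κ} :=
      ⟨⟨∅, by simpa using Cardinal.aleph0_pos.trans_le hκ0⟩⟩
    exact ⟨Function.invFun g, Function.invFun_surjective g.injective⟩
  let S : I → Set (Set ℕ) := fun i => (S' i).1
  have hSsurj : ∀ A : Set (Set ℕ), #A < κ → ∃ β, S β = A := by
    intro A hA
    obtain ⟨β, hβ⟩ := hS' ⟨A, hA⟩
    exact ⟨β, congrArg Subtype.val hβ⟩
  obtain ⟨e, he⟩ := exists_rec (I := I) (StepOK κ S) (fun β e e' a h1 h2 => h2.congr h1)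
    (fun β e h => exists_step hp hI hreg hκc S (fun i => (S' i).2) β e h)
  have hgood : ∀ t : Finset I, ∃ T : Set I, #T < κ ∧ ∀ σ : Finset I, (∀ δ ∈ σ, δ ∉ T) →
      (seqInter e t \ seqUnion e σ).Infinite := by
    intro t
    obtain ⟨T, hT, h⟩ := good_of_step hκ0 Set.univ (fun δ _ => he δ) t (by simp)
    exact ⟨T, hT, fun σ => h σ (by simp)⟩
  have hinf : ∀ t, (seqInter e t).Infinite := by
    intro t
    obtain ⟨T, -, h⟩ := hgood t
    exact (h ∅ (by simp)).mono Set.sdiff_subset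
  have hunion : ∀ t t' : Finset I, seqInter e (t ∪ t') = seqInter e t ∩ seqInter e t' := by
    intro t t'
    ext m
    simp [seqInter, or_imp, forall_and]
  have hsingle : ∀ β, seqInter e {β} = e β := by
    intro β
    ext m
    simp [seqInter]
  let F : Filter ℕ :=
    { sets := {x | ∃ t, (seqInter e t \ x).Finite}
      univ_sets := ⟨∅, by simp⟩
      sets_of_superset := by
        rintro x y ⟨t, ht⟩ hxy
        exact ⟨t, ht.subset (Set.sdiff_subset_sdiff_right hxy)⟩
      inter_sets := by
        rintro x y ⟨t, ht⟩ ⟨t', ht'⟩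
        refine ⟨t ∪ t', (ht.union ht').subset ?_⟩
        rw [hunion]
        rintro m ⟨⟨h1, h2⟩, h3⟩
        by_cases hx : m ∈ x
        · exact Or.inr ⟨h2, fun hy => h3 ⟨hx, hy⟩⟩
        · exact Or.inl ⟨h1, hx⟩ }
  have hF : ∀ x, x ∈ F ↔ ∃ t, (seqInter e t \ x).Finite := fun x => Iff.rfl
  have hFinf : ∀ x ∈ F, x.Infinite := by
    rintro x ⟨t, ht⟩ hx
    refine hinf t ((ht.union hx).subset ?_)
    intro m hm
    by_cases h : m ∈ x
    · exact Or.inr h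
    · exact Or.inl ⟨hm, h⟩
  have hdec : ∀ x, x ∈ F ∨ xᶜ ∈ F := by
    intro x
    obtain ⟨β, hβ⟩ := hSsurj {x} (by simpa using Cardinal.one_lt_aleph0.trans_le hκ0)
    have := (he β).decide
    rw [hβ] at this
    simp only [Set.mem_singleton_iff, forall_eq, exists_eq_left] at this
    rcases this with h | h
    · exact Or.inl ((hF x).2 ⟨{β}, by rwa [hsingle]⟩)
    · refine Or.inr ((hF _).2 ⟨{β}, ?_⟩)
      rw [hsingle]
      refine h.subset ?_
      rintro m ⟨h1, h2⟩
      exact ⟨h1, not_not.1 h2⟩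
  let U : Ultrafilter ℕ := Ultrafilter.ofComplNotMemIff F (by
    intro x
    constructor
    · intro h
      exact (hdec x).resolve_right h
    · intro h h'
      have := hFinf _ (F.inter_sets h h')
      simp at this)
  have hU : ∀ x, x ∈ U ↔ ∃ t, (seqInter e t \ x).Finite := fun x => Iff.rfl
  have hUinf : ∀ x ∈ U, x.Infinite := fun x hx => hFinf x hx
  have heU : ∀ β, e β ∈ U := fun β => (hU _).2 ⟨{β}, by rw [hsingle]; simp⟩
  -- directedness
  have hdir : ∀ A : Set (Set ℕ), #A < κ → (∀ x ∈ A, x ∈ U) →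
      ∃ b ∈ U, ∀ x ∈ A, (b \ x).Finite := by
    intro A hA hAU
    obtain ⟨β, rfl⟩ := hSsurj A hA
    rcases (he β).decide with h | ⟨x, hx, hfin⟩
    · exact ⟨e β, heU β, h⟩
    · exact absurd hfin (hUinf _ (Filter.inter_mem (heU β) (hAU x hx)))
  -- unboundedness
  have hunb : ∀ b ∈ U, #{β | (b \ e β).Finite} < κ := by
    intro b hb
    obtain ⟨t, ht⟩ := (hU b).1 hb
    obtain ⟨T, hT, h⟩ := hgood t
    refine (Cardinal.mk_le_mk_of_subset ?_).trans_lt hT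
    intro β hβ
    by_contra hβT
    refine h {β} (by simpa using hβT) ((ht.union hβ).subset ?_)
    rintro m ⟨h1, h2⟩
    by_cases hm : m ∈ b
    · exact Or.inr ⟨hm, fun h => h2 ⟨β, by simp, h⟩⟩
    · exact Or.inl ⟨h1, hm⟩
  refine ⟨U, ?_, fun C hC => ⟨?_, ?_⟩⟩
  · intro a ha
    have : ({a} : Set ℕ) ∈ U := by rw [ha]; exact Set.mem_singleton a
    exact hUinf _ this (Set.finite_singleton a)
  · have hle : #{A : Set ℕ // A ∈ U} ≤ #C := by
      rw [hC]
      refine (Cardinal.mk_subtype_le _).trans ?_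
      simp
    obtain ⟨g⟩ := hle
    refine ⟨fun x => ⟨{g x}, by simpa using Cardinal.one_lt_aleph0.trans_le hκ0⟩, ?_⟩
    rintro Q hQ ⟨⟨b, hb⟩, hbd⟩
    apply hQ
    have hQc : #Q < κ := by
      refine lt_of_le_of_lt ?_ hb
      refine Cardinal.mk_le_of_injective (f := fun x : Q => (⟨g x.1, ?_⟩ : b)) ?_
      · exact hbd _ ⟨x.1, x.2, rfl⟩ (Set.mem_singleton _)
      · intro x y hxy
        exact Subtype.ext (g.injective (congrArg Subtype.val hxy))
    obtain ⟨c, hc, hc'⟩ := hdir (Subtype.val '' Q) (Cardinal.mk_image_le.trans_lt hQc) (by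
      rintro _ ⟨x, -, rfl⟩
      exact x.2)
    exact ⟨⟨c, hc⟩, fun x hx => hc' _ ⟨x, hx, rfl⟩⟩
  · obtain ⟨g⟩ : Nonempty (C ≃ I) := Cardinal.eq.1 (hC.trans hIc.symm)
    have hbound : ∀ s : {s : Set C // #s < κ}, ∃ b : {A : Set ℕ // A ∈ U},
        ∀ x ∈ s.1, (b.1 \ e (g x)).Finite := by
      intro s
      obtain ⟨b, hb, hb'⟩ := hdir ((fun x => e (g x)) '' s.1)
        (Cardinal.mk_image_le.trans_lt s.2) (by
          rintro _ ⟨x, -, rfl⟩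
          exact heU _)
      exact ⟨⟨b, hb⟩, fun x hx => hb' _ ⟨x, hx, rfl⟩⟩
    choose f hf using hbound
    refine ⟨f, ?_⟩
    rintro Q hQ ⟨⟨b, hb⟩, hbd⟩
    apply hQ
    refine ⟨⟨g ⁻¹' {β | (b \ e β).Finite}, ?_⟩, ?_⟩
    · exact (Cardinal.mk_preimage_of_injective _ _ g.injective).trans_lt (hunb b hb)
    · intro s hs x hx
      have h1 : (b \ (f s).1).Finite := hbd _ ⟨s, hs, rfl⟩
      have h2 := hf s x hx
      refine (h1.union h2).subset ?_
      rintro m ⟨hm1, hm2⟩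
      by_cases hm : m ∈ (f s).1
      · exact Or.inr ⟨hm, hm2⟩
      · exact Or.inl ⟨hm1, hm⟩
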